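/- arXiv:gr-qc/9510068 — 2 statements merged into one kernel-verified Lean document; each statement's English description precedes it below -/
import Mathlib

section
/- Fix m > 0 and for q ∈ ℝ³ set p(q) = (√(m² + |q|²), q₁, q₂, q₃) ∈ ℝ⁴, with Minkowski inner product ⟨u,v⟩ = −u₀v₀ + u₁v₁ + u₂v₂ + u₃v₃ and mass-shell measure dω(q) = dq/√(m² + |q|²). Let f : (−∞,0) × (−∞,0) → ℝ be three times continuously differentiable and write A = ∂³f/∂x²∂y, B = ∂³f/∂y³, C = ∂³f/∂x∂y². Assume A ≥ 0, B ≥ 0 and C² ≤ A·B at every point of the domain. Let ζ ∈ ℝ, let ξ and t be future-directed timelike vectors, let Z, δZ be symmetric Minkowski trace-free 4×4 matrices, δv ∈ ℝ⁴, δζ ∈ ℝ, and assume x(q) := ζ + Z(p(q), p(q)) < 0 for all q ∈ ℝ³. Set y(q) = ⟨ξ, p(q)⟩, δx(q) = δζ + δZ(p(q), p(q)), δy(q) = ⟨δv, p(q)⟩. If the function q ↦ ⟨t, p(q)⟩·[A(x(q),y(q))·δx(q)² + B(x(q),y(q))·δy(q)² + 2·C(x(q),y(q))·δx(q)·δy(q)]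 is integrable with respect to dω, then its integral over ℝ³ is ≤ 0. -/
open MeasureTheory Set

/-- The Minkowski inner product on `ℝ⁴`. -/
def mink (u v : Fin 4 → ℝ) : ℝ :=
  -(u 0 * v 0) + u 1 * v 1 + u 2 * v 2 + u 3 * v 3

/-- The quadratic form `Z(u,u) = Σ_{a,b} Z_{ab} u_a u_b` of a `4×4` matrix. -/
def quad (Z : Fin 4 → Fin 4 → ℝ) (u : Fin 4 → ℝ) : ℝ :=
  ∑ a : Fin 4, ∑ b : Fin 4, Z a b * u a * u b

/-- The future mass shell of mass `m`, parametrized by `q ∈ ℝ³`: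
`p(q) = (√(m² + |q|²), q)`. -/
noncomputable def pshell (m : ℝ) (q : Fin 3 → ℝ) : Fin 4 → ℝ :=
  ![Real.sqrt (m ^ 2 + (q 0 ^ 2 + q 1 ^ 2 + q 2 ^ 2)), q 0, q 1, q 2]

/-- A future-directed timelike vector has negative Minkowski product with every point of the
future mass shell. -/
theorem mink_pshell_neg {m : ℝ} (hm : 0 < m) {t : Fin 4 → ℝ} (ht0 : 0 < t 0)
    (htt : mink t t < 0) (q : Fin 3 → ℝ) : mink t (pshell m q) < 0 := by
  have hr : 0 < m ^ 2 + (q 0 ^ 2 + q 1 ^ 2 + q 2 ^ 2) := by positivity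
  have hE := Real.sqrt_pos.mpr hr
  have hE2 := Real.sq_sqrt hr.le
  simp only [mink, pshell, Matrix.cons_val] at htt ⊢
  set E := Real.sqrt (m ^ 2 + (q 0 ^ 2 + q 1 ^ 2 + q 2 ^ 2))
  have cauchy_schwarz : (t 1 * q 0 + t 2 * q 1 + t 3 * q 2) ^ 2 ≤
      (t 1 ^ 2 + t 2 ^ 2 + t 3 ^ 2) * (q 0 ^ 2 + q 1 ^ 2 + q 2 ^ 2) := by
    linarith [sq_nonneg (t 1 * q 1 - t 2 * q 0), sq_nonneg (t 1 * q 2 - t 3 * q 0),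
      sq_nonneg (t 2 * q 2 - t 3 * q 1)]
  have spatial_le : (t 1 ^ 2 + t 2 ^ 2 + t 3 ^ 2) * (q 0 ^ 2 + q 1 ^ 2 + q 2 ^ 2) ≤
      t 0 ^ 2 * (q 0 ^ 2 + q 1 ^ 2 + q 2 ^ 2) :=
    mul_le_mul_of_nonneg_right (by linarith) (by positivity)
  have mass_pos : 0 < t 0 ^ 2 * m ^ 2 := by positivity
  have hlt : t 1 * q 0 + t 2 * q 1 + t 3 * q 2 < t 0 * E := by
    refine lt_of_pow_lt_pow_left₀ 2 (by positivity) ?_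
    rw [mul_pow, hE2]
    linarith
  linarith

/-- A binary quadratic form with nonnegative diagonal and nonnegative determinant is
nonnegative. -/
theorem binary_quadratic_form_nonneg {A B C : ℝ} (hA : 0 ≤ A) (hB : 0 ≤ B)
    (hC : C ^ 2 ≤ A * B) (a b : ℝ) : 0 ≤ A * a ^ 2 + B * b ^ 2 + 2 * C * a * b := by
  have hsq : (2 * C * a * b) ^ 2 ≤ (A * a ^ 2 + B * b ^ 2) ^ 2 := by
    linarith [sq_nonneg (A * a ^ 2 - B * b ^ 2),
      mul_le_mul_of_nonneg_right hC (by positivity : 0 ≤ (a * b) ^ 2)]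
  linarith [(abs_le_of_sq_le_sq' hsq (by positivity)).1]

/-- Theorem 2 of the paper (manifestly causal pseudo-statistical theories):
if `f(x,y)` is `C³` on `(-∞,0) × (-∞,0)` with `A = f_{xxy} ≥ 0`, `B = f_{yyy} ≥ 0`
and `C = f_{xyy}` satisfying `C² ≤ A·B`, then the causality integral
`∫ ⟨t, p⟩ [A δx² + B δy² + 2C δx δy] dω` over the future mass shell is `≤ 0`. -/
theorem stmt_12 (m : ℝ) (hm : 0 < m)
    (f : ℝ → ℝ → ℝ)
    (hf : ContDiffOn ℝ 3 (fun p : ℝ × ℝ => f p.1 p.2) (Iio 0 ×ˢ Iio 0))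
    (A B C : ℝ → ℝ → ℝ)
    (hAdef : ∀ x < (0:ℝ), ∀ y < (0:ℝ),
      A x y = deriv (fun x₁ => deriv (fun x₂ => deriv (f x₂) y) x₁) x)
    (hBdef : ∀ x < (0:ℝ), ∀ y < (0:ℝ), B x y = iteratedDeriv 3 (f x) y)
    (hCdef : ∀ x < (0:ℝ), ∀ y < (0:ℝ),
      C x y = deriv (fun x' => iteratedDeriv 2 (f x') y) x)
    (hApos : ∀ x < (0:ℝ), ∀ y < (0:ℝ), 0 ≤ A x y)
    (hBpos : ∀ x < (0:ℝ), ∀ y < (0:ℝ), 0 ≤ B x y)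
    (hCbound : ∀ x < (0:ℝ), ∀ y < (0:ℝ), C x y ^ 2 ≤ A x y * B x y)
    (ζ : ℝ)
    (ξ t : Fin 4 → ℝ)
    (hξ0 : 0 < ξ 0) (hξξ : mink ξ ξ < 0)
    (ht0 : 0 < t 0) (htt : mink t t < 0)
    (Z δZ : Fin 4 → Fin 4 → ℝ)
    (hZsymm : ∀ a b, Z a b = Z b a)
    (hZtrace : -Z 0 0 + Z 1 1 + Z 2 2 + Z 3 3 = 0)
    (hδZsymm : ∀ a b, δZ a b = δZ b a)
    (hδZtrace : -δZ 0 0 + δZ 1 1 + δZ 2 2 + δZ 3 3 = 0)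
    (δv : Fin 4 → ℝ) (δζ : ℝ)
    (hxneg : ∀ q : Fin 3 → ℝ, ζ + quad Z (pshell m q) < 0)
    (hint : Integrable (fun q : Fin 3 → ℝ =>
      mink t (pshell m q) *
        (A (ζ + quad Z (pshell m q)) (mink ξ (pshell m q)) *
            (δζ + quad δZ (pshell m q)) ^ 2 +
          B (ζ + quad Z (pshell m q)) (mink ξ (pshell m q)) *
            (mink δv (pshell m q)) ^ 2 +
          2 * C (ζ + quad Z (pshell m q)) (mink ξ (pshell m q)) *
            (δζ + quad δZ (pshell m q)) * mink δv (pshell m q)) /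
          Real.sqrt (m ^ 2 + (q 0 ^ 2 + q 1 ^ 2 + q 2 ^ 2)))) :
    (∫ q : Fin 3 → ℝ,
      mink t (pshell m q) *
        (A (ζ + quad Z (pshell m q)) (mink ξ (pshell m q)) *
            (δζ + quad δZ (pshell m q)) ^ 2 +
          B (ζ + quad Z (pshell m q)) (mink ξ (pshell m q)) *
            (mink δv (pshell m q)) ^ 2 +
          2 * C (ζ + quad Z (pshell m q)) (mink ξ (pshell m q)) *
            (δζ + quad δZ (pshell m q)) * mink δv (pshell m q)) /
          Real.sqrt (m ^ 2 + (q 0 ^ 2 + q 1 ^ 2 + q 2 ^ 2))) ≤ 0 := by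
  refine integral_nonpos fun q => ?_
  have hy := mink_pshell_neg hm hξ0 hξξ q
  exact div_nonpos_of_nonpos_of_nonneg
    (mul_nonpos_of_nonpos_of_nonneg (mink_pshell_neg hm ht0 htt q).le
      (binary_quadratic_form_nonneg (hApos _ (hxneg q) _ hy) (hBpos _ (hxneg q) _ hy)
        (hCbound _ (hxneg q) _ hy) _ _))
    (Real.sqrt_nonneg _)
end

section
/- Fix m > 0 and for q ∈ ℝ³ set p(q) = (√(m² + |q|²), q₁, q₂, q₃) ∈ ℝ⁴, with Minkowski inner product ⟨u,v⟩ = −u₀v₀ + u₁v₁ + u₂v₂ + u₃v₃. Let ζ ∈ ℝ, ξ ∈ ℝ⁴, and let Z be a symmetric real 4×4 matrix. If ζ + ⟨ξ, p(q)⟩ + Z(p(q), p(q)) ≤ 0 for every q ∈ ℝ³, then Z(l, l) ≤ 0 for every future-directed null vector l (i.e., every l ∈ ℝ⁴ with l₀ > 0 and −l₀² + l₁² + l₂² + l₃² = 0), where Z(u,u) = Σ_{a,b} Z_{ab} u_a u_b. -/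
theorem mink_smul_right (c : ℝ) (u v : Fin 4 → ℝ) : mink u (c • v) = c * mink u v := by
  simp only [mink, Pi.smul_apply, smul_eq_mul]
  ring

theorem quad_smul (Z : Fin 4 → Fin 4 → ℝ) (c : ℝ) (u : Fin 4 → ℝ) :
    quad Z (c • u) = c ^ 2 * quad Z u := by
  simp only [quad, Pi.smul_apply, smul_eq_mul, Finset.mul_sum]
  exact Finset.sum_congr rfl fun a _ => Finset.sum_congr rfl fun b _ => by ring

theorem continuous_mink_right (u : Fin 4 → ℝ) : Continuous (mink u) := by
  unfold mink
  fun_prop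

theorem continuous_quad (Z : Fin 4 → Fin 4 → ℝ) : Continuous (quad Z) := by
  unfold quad
  fun_prop

/-- Rescaling the mass shell rescales its mass. -/
theorem pshell_smul {c : ℝ} (hc : 0 ≤ c) (m : ℝ) (q : Fin 3 → ℝ) :
    pshell (c * m) (c • q) = c • pshell m q := by
  have hsqrt : Real.sqrt ((c * m) ^ 2 + ((c * q 0) ^ 2 + (c * q 1) ^ 2 + (c * q 2) ^ 2)) =
      c * Real.sqrt (m ^ 2 + (q 0 ^ 2 + q 1 ^ 2 + q 2 ^ 2)) := by
    rw [← Real.sqrt_sq hc, ← Real.sqrt_mul (sq_nonneg c), Real.sqrt_sq hc]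
    ring_nf
  ext i
  fin_cases i <;> simp [pshell, hsqrt]

theorem continuous_pshell_mass (q : Fin 3 → ℝ) : Continuous fun m => pshell m q := by
  refine continuous_pi fun i => ?_
  fin_cases i <;> simp only [pshell] <;> simp <;> fun_prop

/-- The massless shell consists of the future-directed null vectors. -/
theorem pshell_zero_of_null {l : Fin 4 → ℝ} (hl0 : 0 ≤ l 0)
    (hl : -l 0 ^ 2 + l 1 ^ 2 + l 2 ^ 2 + l 3 ^ 2 = 0) :
    pshell 0 ![l 1, l 2, l 3] = l := by
  have hsq : l 1 ^ 2 + l 2 ^ 2 + l 3 ^ 2 = l 0 ^ 2 := by linarith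
  ext i
  fin_cases i <;> simp [pshell, hsq, Real.sqrt_sq hl0]

/-- Necessity part of the paper's characterization of the cone `C⁻`: if
`ζ + ⟨ξ, p(q)⟩ + Z(p(q), p(q)) ≤ 0` on the whole future mass shell, then
`Z(l,l) ≤ 0` for every future-directed null vector `l`. -/
theorem stmt_14 (m : ℝ) (hm : 0 < m)
    (ζ : ℝ) (ξ : Fin 4 → ℝ) (Z : Fin 4 → Fin 4 → ℝ)
    (hsymm : ∀ a b, Z a b = Z b a)
    (h : ∀ q : Fin 3 → ℝ, ζ + mink ξ (pshell m q) + quad Z (pshell m q) ≤ 0) :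
    ∀ l : Fin 4 → ℝ, 0 < l 0 →
      -l 0 ^ 2 + l 1 ^ 2 + l 2 ^ 2 + l 3 ^ 2 = 0 → quad Z l ≤ 0 := by
  intro l hl0 hl
  set q : Fin 3 → ℝ := ![l 1, l 2, l 3] with hq
  let F : ℝ → ℝ := fun c =>
    c ^ 2 * ζ + c * mink ξ (pshell (c * m) q) + quad Z (pshell (c * m) q)
  have hshell : Continuous fun c : ℝ => pshell (c * m) q :=
    (continuous_pshell_mass q).comp (continuous_mul_const m)
  have hF : Continuous F :=
    ((by fun_prop : Continuous fun c : ℝ => c ^ 2 * ζ).add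
      (continuous_id.mul ((continuous_mink_right ξ).comp hshell))).add
      ((continuous_quad Z).comp hshell)
  have hF0 : F 0 = quad Z l := by
    simp [F, hq, pshell_zero_of_null hl0.le hl]
  have hFneg : ∀ c : ℝ, 0 < c → F c ≤ 0 := by
    intro c hc
    have hscale : pshell (c * m) q = c • pshell m (c⁻¹ • q) := by
      rw [← pshell_smul hc.le, smul_inv_smul₀ hc.ne']
    have hFc : F c = c ^ 2 * (ζ + mink ξ (pshell m (c⁻¹ • q)) +
        quad Z (pshell m (c⁻¹ • q))) := by
      simp only [F, hscale, mink_smul_right, quad_smul]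
      ring
    rw [hFc]
    exact mul_nonpos_of_nonneg_of_nonpos (sq_nonneg c) (h _)
  rw [← hF0]
  exact le_of_tendsto (hF.continuousWithinAt (s := Set.Ioi 0) (x := 0))
    (Filter.eventually_of_mem self_mem_nhdsWithin hFneg)
end
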